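/- arXiv:math/9806131 — 5 statements merged into one kernel-verified Lean document; each statement's English description precedes it below -/
import Mathlib

section
/- For every γ ∈ G and every integer n ≥ 1, if α ≥ 0 satisfies the branching condition, then Σ_{θ∈G} m^n(γ,θ) ≤ Σ_{θ∈G} |θ|·m^n(γ,θ) ≤ |γ|·α^n. -/
open scoped ENNReal Classical

/-- The branching kernel `m(γ,θ) = e^{-β|θ|} 1{θ ≁ γ}` of the multitype branching
process dominating the clan of ancestors.  Here `inc θ γ` means "θ is incompatible
with γ" and `w` is the weight (number of plaquettes) function. -/
noncomputable def contourKernel {G : Type*} (w : G → ℝ) (inc : G → G → Prop) (β : ℝ)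
    (γ θ : G) : ℝ≥0∞ :=
  if inc θ γ then ENNReal.ofReal (Real.exp (-β * w θ)) else 0

/-- Iterates of the kernel: `m⁰(γ,θ) = 1{θ = γ}` and
`m^{n+1}(γ,θ) = Σ_{γ'} m(γ,γ')·m^n(γ',θ)`. -/
noncomputable def contourKernelIter {G : Type*} (w : G → ℝ) (inc : G → G → Prop) (β : ℝ) :
    ℕ → G → G → ℝ≥0∞
  | 0, γ, θ => if θ = γ then 1 else 0
  | n + 1, γ, θ => ∑' γ' : G, contourKernel w inc β γ γ' * contourKernelIter w inc β n γ' θ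

theorem tsum_weight_mul_contourKernelIter_le {G : Type*} (w : G → ℝ) (inc : G → G → Prop)
    (β α : ℝ)
    (hbranch : ∀ γ : G,
      ∑' θ : G, ENNReal.ofReal (w θ) * contourKernel w inc β γ θ ≤
        ENNReal.ofReal α * ENNReal.ofReal (w γ))
    (n : ℕ) (γ : G) :
    ∑' θ : G, ENNReal.ofReal (w θ) * contourKernelIter w inc β n γ θ ≤
      ENNReal.ofReal (w γ) * ENNReal.ofReal α ^ n := by
  induction n generalizing γ with
  | zero => simp [contourKernelIter]
  | succ n ih =>
    calc ∑' θ : G, ENNReal.ofReal (w θ) * contourKernelIter w inc β (n + 1) γ θ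
        = ∑' γ' : G, contourKernel w inc β γ γ' *
            ∑' θ : G, ENNReal.ofReal (w θ) * contourKernelIter w inc β n γ' θ := by
          simp only [contourKernelIter, ← ENNReal.tsum_mul_left]
          rw [ENNReal.tsum_comm]
          simp only [mul_left_comm]
      _ ≤ ∑' γ' : G, contourKernel w inc β γ γ' *
            (ENNReal.ofReal (w γ') * ENNReal.ofReal α ^ n) := by
          gcongr with γ'
          exact ih γ'
      _ = (∑' γ' : G, ENNReal.ofReal (w γ') * contourKernel w inc β γ γ') *
            ENNReal.ofReal α ^ n := by
          rw [← ENNReal.tsum_mul_right]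
          exact tsum_congr fun γ' => by ring
      _ ≤ ENNReal.ofReal α * ENNReal.ofReal (w γ) * ENNReal.ofReal α ^ n := by
          gcongr
          exact hbranch γ
      _ = ENNReal.ofReal (w γ) * ENNReal.ofReal α ^ (n + 1) := by ring

/-- Lemma 5.1 of Fernández–Ferrari–García: if `α` satisfies the branching condition
`Σ_{θ ≁ γ} |θ| e^{-β|θ|} ≤ α|γ|`, then for all `n ≥ 1`,
`Σ_θ m^n(γ,θ) ≤ Σ_θ |θ| m^n(γ,θ) ≤ |γ| αⁿ`. -/
theorem sum_kernelIter_le {G : Type*} [Countable G] (w : G → ℝ) (hw : ∀ γ : G, 1 ≤ w γ)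
    (inc : G → G → Prop) (β : ℝ) (α : ℝ) (hα : 0 ≤ α)
    (hbranch : ∀ γ : G,
      ∑' θ : G, ENNReal.ofReal (w θ) * contourKernel w inc β γ θ ≤
        ENNReal.ofReal α * ENNReal.ofReal (w γ))
    (γ : G) (n : ℕ) (hn : 1 ≤ n) :
    (∑' θ : G, contourKernelIter w inc β n γ θ ≤
        ∑' θ : G, ENNReal.ofReal (w θ) * contourKernelIter w inc β n γ θ) ∧
      ∑' θ : G, ENNReal.ofReal (w θ) * contourKernelIter w inc β n γ θ ≤
        ENNReal.ofReal (w γ) * ENNReal.ofReal α ^ n := by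
  refine ⟨ENNReal.tsum_le_tsum fun θ => le_mul_of_one_le_left' ?_,
    tsum_weight_mul_contourKernelIter_le w inc β α hbranch n γ⟩
  exact ENNReal.one_le_ofReal.2 (hw θ)
end

section
/- If α ≥ 0 satisfies the branching condition and α < 1, then for every γ ∈ G the double sum Σ_{n≥1} Σ_{θ∈G} m^n(γ,θ) is at most |γ|·α/(1−α); in particular it is finite. (This is the summability condition Σ_n Σ_θ m^n(γ,θ) < ∞ which, via Borel–Cantelli, yields the absence of backward oriented percolation in Theorem 5.3(i).) -/
open scoped ENNReal Classical

/-- If the weight `w` satisfies `m w ≤ α w` for the kernel `m`, then `m^n w ≤ α^n w`. -/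
theorem tsum_kernelIter_mul_weight_le {G : Type*} (w : G → ℝ) (inc : G → G → Prop) (β α : ℝ)
    (hbranch : ∀ γ : G,
      ∑' θ : G, ENNReal.ofReal (w θ) * contourKernel w inc β γ θ ≤
        ENNReal.ofReal α * ENNReal.ofReal (w γ))
    (n : ℕ) (γ : G) :
    ∑' θ : G, contourKernelIter w inc β n γ θ * ENNReal.ofReal (w θ) ≤
      ENNReal.ofReal α ^ n * ENNReal.ofReal (w γ) := by
  induction n generalizing γ with
  | zero => simp [contourKernelIter]
  | succ n ih =>
    calc ∑' θ : G, contourKernelIter w inc β (n + 1) γ θ * ENNReal.ofReal (w θ)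
        = ∑' θ : G, ∑' γ' : G, contourKernel w inc β γ γ' *
            (contourKernelIter w inc β n γ' θ * ENNReal.ofReal (w θ)) := by
          simp only [contourKernelIter, ← ENNReal.tsum_mul_right, mul_assoc]
      _ = ∑' γ' : G, contourKernel w inc β γ γ' *
            ∑' θ : G, contourKernelIter w inc β n γ' θ * ENNReal.ofReal (w θ) := by
          rw [ENNReal.tsum_comm]
          simp only [ENNReal.tsum_mul_left]
      _ ≤ ∑' γ' : G, contourKernel w inc β γ γ' *
            (ENNReal.ofReal α ^ n * ENNReal.ofReal (w γ')) := by
          gcongr with γ'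
          exact ih γ'
      _ = ENNReal.ofReal α ^ n *
            ∑' γ' : G, ENNReal.ofReal (w γ') * contourKernel w inc β γ γ' := by
          rw [← ENNReal.tsum_mul_left]
          exact tsum_congr fun γ' => by ring
      _ ≤ ENNReal.ofReal α ^ n * (ENNReal.ofReal α * ENNReal.ofReal (w γ)) := by
          gcongr
          exact hbranch γ
      _ = ENNReal.ofReal α ^ (n + 1) * ENNReal.ofReal (w γ) := by ring

/-- If `α < 1` satisfies the branching condition, then
`Σ_{n≥1} Σ_θ m^n(γ,θ) ≤ |γ|·α/(1-α) < ∞` — the summability condition which, via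
Borel–Cantelli, yields absence of backward oriented percolation (Theorem 5.3(i)). -/
theorem tsum_tsum_kernelIter_le {G : Type*} [Countable G] (w : G → ℝ)
    (hw : ∀ γ : G, 1 ≤ w γ) (inc : G → G → Prop) (β : ℝ) (α : ℝ) (hα : 0 ≤ α) (hα1 : α < 1)
    (hbranch : ∀ γ : G,
      ∑' θ : G, ENNReal.ofReal (w θ) * contourKernel w inc β γ θ ≤
        ENNReal.ofReal α * ENNReal.ofReal (w γ))
    (γ : G) :
    ∑' n : ℕ, ∑' θ : G, contourKernelIter w inc β (n + 1) γ θ ≤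
      ENNReal.ofReal (w γ * α / (1 - α)) := by
  have hsum (n : ℕ) : ∑' θ : G, contourKernelIter w inc β (n + 1) γ θ ≤
      ENNReal.ofReal α ^ (n + 1) * ENNReal.ofReal (w γ) :=
    (ENNReal.tsum_le_tsum fun θ => le_mul_of_one_le_right' (by simpa using hw θ)).trans
      (tsum_kernelIter_mul_weight_le w inc β α hbranch (n + 1) γ)
  have hγ : 0 ≤ w γ := zero_le_one.trans (hw γ)
  calc ∑' n : ℕ, ∑' θ : G, contourKernelIter w inc β (n + 1) γ θ
      ≤ ∑' n : ℕ, ENNReal.ofReal α ^ (n + 1) * ENNReal.ofReal (w γ) :=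
        ENNReal.tsum_le_tsum hsum
    _ = ENNReal.ofReal α * (1 - ENNReal.ofReal α)⁻¹ * ENNReal.ofReal (w γ) := by
        rw [ENNReal.tsum_mul_right, ENNReal.tsum_geometric_add_one]
    _ = ENNReal.ofReal (w γ * α / (1 - α)) := by
        rw [ENNReal.ofReal_div_of_pos (sub_pos.mpr hα1), ENNReal.ofReal_mul hγ,
          ENNReal.ofReal_sub _ hα, ENNReal.ofReal_one, ENNReal.div_eq_inv_mul]
        ring
end

section
/- If α ≥ 0 satisfies the branching condition, then for every γ ∈ G and every t ≥ 0, the quantity R_t(γ) := e^{−t} Σ_{n≥0} (t^n/n!) Σ_{θ∈G} m^n(γ,θ) satisfies R_t(γ) ≤ |γ|·e^{(α−1)t}. (R_t(γ) is the mean total number of individuals at time t in the continuous-time multitype branching process with Poisson offspring means m started from one individual of type γ; this is the bound of Lemma 5.2.) -/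
open scoped ENNReal Classical

/-- Under the branching condition the row sums of the `n`-th iterate are at most `αⁿ |γ|`. -/
theorem tsum_contourKernelIter_le {G : Type*} {w : G → ℝ} (hw : ∀ γ : G, 1 ≤ w γ)
    {inc : G → G → Prop} {β : ℝ} {a : ℝ≥0∞}
    (hbranch : ∀ γ : G, ∑' θ : G, ENNReal.ofReal (w θ) * contourKernel w inc β γ θ ≤
      a * ENNReal.ofReal (w γ)) (n : ℕ) (γ : G) :
    ∑' θ : G, contourKernelIter w inc β n γ θ ≤ a ^ n * ENNReal.ofReal (w γ) := by
  induction n generalizing γ with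
  | zero => simpa [contourKernelIter] using hw γ
  | succ n ih =>
    calc ∑' θ : G, contourKernelIter w inc β (n + 1) γ θ
        = ∑' γ' : G, contourKernel w inc β γ γ' *
            ∑' θ : G, contourKernelIter w inc β n γ' θ := by
          simp only [contourKernelIter]
          rw [ENNReal.tsum_comm]
          simp only [ENNReal.tsum_mul_left]
      _ ≤ ∑' γ' : G, contourKernel w inc β γ γ' * (a ^ n * ENNReal.ofReal (w γ')) := by
          gcongr with γ'
          exact ih γ'
      _ = a ^ n * ∑' γ' : G, ENNReal.ofReal (w γ') * contourKernel w inc β γ γ' := by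
          rw [← ENNReal.tsum_mul_left]
          congr 1 with γ'
          ring
      _ ≤ a ^ n * (a * ENNReal.ofReal (w γ)) := by
          gcongr
          exact hbranch γ
      _ = a ^ (n + 1) * ENNReal.ofReal (w γ) := by ring

/-- The exponential series of a nonnegative real, summed in `ℝ≥0∞`. -/
theorem ENNReal.tsum_ofReal_pow_div_factorial {x : ℝ} (hx : 0 ≤ x) :
    ∑' n : ℕ, ENNReal.ofReal (x ^ n / n.factorial) = ENNReal.ofReal (Real.exp x) := by
  rw [← ENNReal.ofReal_tsum_of_nonneg (fun n => by positivity) (Real.summable_pow_div_factorial x),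
    Real.exp_eq_exp_ℝ, NormedSpace.exp_eq_tsum_div]

/-- Lemma 5.2 of Fernández–Ferrari–García: the mean total number of branches
`R_t(γ) = e^{-t} Σ_{n≥0} (tⁿ/n!) Σ_θ m^n(γ,θ)` of the continuous-time multitype
branching process started from one individual of type `γ` satisfies
`R_t(γ) ≤ |γ| e^{(α-1)t}`. -/
theorem meanBranches_le {G : Type*} [Countable G] (w : G → ℝ) (hw : ∀ γ : G, 1 ≤ w γ)
    (inc : G → G → Prop) (β : ℝ) (α : ℝ) (hα : 0 ≤ α)
    (hbranch : ∀ γ : G,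
      ∑' θ : G, ENNReal.ofReal (w θ) * contourKernel w inc β γ θ ≤
        ENNReal.ofReal α * ENNReal.ofReal (w γ))
    (γ : G) (t : ℝ) (ht : 0 ≤ t) :
    ENNReal.ofReal (Real.exp (-t)) *
        ∑' n : ℕ, ENNReal.ofReal (t ^ n / n.factorial) *
          ∑' θ : G, contourKernelIter w inc β n γ θ ≤
      ENNReal.ofReal (w γ * Real.exp ((α - 1) * t)) := by
  have hterm (n : ℕ) : ENNReal.ofReal (t ^ n / n.factorial) *
      ∑' θ : G, contourKernelIter w inc β n γ θ ≤
        ENNReal.ofReal ((α * t) ^ n / n.factorial) * ENNReal.ofReal (w γ) := by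
    calc _ ≤ ENNReal.ofReal (t ^ n / n.factorial) *
          (ENNReal.ofReal α ^ n * ENNReal.ofReal (w γ)) := by
          gcongr
          exact tsum_contourKernelIter_le hw hbranch n γ
      _ = _ := by
          rw [← mul_assoc, ← ENNReal.ofReal_pow hα, ← ENNReal.ofReal_mul (by positivity)]
          congr 2
          ring
  calc _ ≤ ENNReal.ofReal (Real.exp (-t)) *
        ∑' n : ℕ, ENNReal.ofReal ((α * t) ^ n / n.factorial) * ENNReal.ofReal (w γ) := by
        exact mul_le_mul' le_rfl (ENNReal.tsum_le_tsum hterm)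
    _ = _ := by
        rw [ENNReal.tsum_mul_right, ENNReal.tsum_ofReal_pow_div_factorial (by positivity),
          ← ENNReal.ofReal_mul (by positivity), ← ENNReal.ofReal_mul (by positivity),
          mul_comm (Real.exp (α * t)), mul_left_comm, ← Real.exp_add]
        ring_nf
end

section
/- If α ≥ 0 satisfies the branching condition (in particular α < ∞), then for every γ ∈ G and every t ≥ 0, Σ_{n≥0} (t^n/n!) Σ_{θ∈G} m^n(γ,θ) ≤ |γ|·e^{αt}; in particular this sum is finite. (This is the key estimate Σ_θ (e^{mt})(γ,θ) ≤ |γ| e^{tα} < ∞ of the theorem showing that α(β) < ∞ implies that the clan of ancestors restricted to a finite time interval is finite almost surely, which proves Theorem 2.1.) -/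
open scoped ENNReal Classical

/-- Iterated branching bound `Σ_θ |θ| m^n(γ,θ) ≤ αⁿ |γ|`. -/
theorem tsum_ofReal_mul_contourKernelIter_le {G : Type*} (w : G → ℝ)
    (inc : G → G → Prop) (β α : ℝ)
    (hbranch : ∀ γ : G,
      ∑' θ : G, ENNReal.ofReal (w θ) * contourKernel w inc β γ θ ≤
        ENNReal.ofReal α * ENNReal.ofReal (w γ)) (n : ℕ) (γ : G) :
    ∑' θ : G, ENNReal.ofReal (w θ) * contourKernelIter w inc β n γ θ ≤
      ENNReal.ofReal α ^ n * ENNReal.ofReal (w γ) := by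
  induction n generalizing γ with
  | zero =>
    simp only [contourKernelIter, mul_ite, mul_one, mul_zero, tsum_ite_eq, pow_zero, one_mul,
      le_refl]
  | succ n ih =>
    calc ∑' θ, ENNReal.ofReal (w θ) * contourKernelIter w inc β (n + 1) γ θ
        = ∑' θ, ∑' γ', contourKernel w inc β γ γ' *
            (ENNReal.ofReal (w θ) * contourKernelIter w inc β n γ' θ) := by
          simp only [contourKernelIter, ← ENNReal.tsum_mul_left, mul_left_comm]
      _ = ∑' γ', contourKernel w inc β γ γ' *
            ∑' θ, ENNReal.ofReal (w θ) * contourKernelIter w inc β n γ' θ := by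
          rw [ENNReal.tsum_comm]
          simp only [ENNReal.tsum_mul_left]
      _ ≤ ∑' γ', contourKernel w inc β γ γ' *
            (ENNReal.ofReal α ^ n * ENNReal.ofReal (w γ')) := by
          gcongr with γ'
          exact ih γ'
      _ = ENNReal.ofReal α ^ n * ∑' γ', ENNReal.ofReal (w γ') * contourKernel w inc β γ γ' := by
          rw [← ENNReal.tsum_mul_left]
          exact tsum_congr fun _ => by ring
      _ ≤ ENNReal.ofReal α ^ n * (ENNReal.ofReal α * ENNReal.ofReal (w γ)) := by
          gcongr
          exact hbranch γ
      _ = ENNReal.ofReal α ^ (n + 1) * ENNReal.ofReal (w γ) := by ring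

/-- Key estimate of Theorem 6.1 (proving Theorem 2.1): if `α` satisfies the branching
condition then `Σ_θ (e^{mt})(γ,θ) = Σ_{n≥0} (tⁿ/n!) Σ_θ m^n(γ,θ) ≤ |γ| e^{αt} < ∞`. -/
theorem expKernel_le {G : Type*} [Countable G] (w : G → ℝ) (hw : ∀ γ : G, 1 ≤ w γ)
    (inc : G → G → Prop) (β : ℝ) (α : ℝ) (hα : 0 ≤ α)
    (hbranch : ∀ γ : G,
      ∑' θ : G, ENNReal.ofReal (w θ) * contourKernel w inc β γ θ ≤
        ENNReal.ofReal α * ENNReal.ofReal (w γ))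
    (γ : G) (t : ℝ) (ht : 0 ≤ t) :
    ∑' n : ℕ, ENNReal.ofReal (t ^ n / n.factorial) *
        ∑' θ : G, contourKernelIter w inc β n γ θ ≤
      ENNReal.ofReal (w γ * Real.exp (α * t)) := by
  have hterm (n : ℕ) : ENNReal.ofReal (t ^ n / n.factorial) *
      ∑' θ : G, contourKernelIter w inc β n γ θ ≤
        ENNReal.ofReal (w γ * ((α * t) ^ n / n.factorial)) := by
    calc ENNReal.ofReal (t ^ n / n.factorial) * ∑' θ : G, contourKernelIter w inc β n γ θ
        ≤ ENNReal.ofReal (t ^ n / n.factorial) *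
            ∑' θ : G, ENNReal.ofReal (w θ) * contourKernelIter w inc β n γ θ := by
          gcongr with θ
          exact le_mul_of_one_le_left' (ENNReal.one_le_ofReal.2 (hw θ))
      _ ≤ ENNReal.ofReal (t ^ n / n.factorial) *
            (ENNReal.ofReal α ^ n * ENNReal.ofReal (w γ)) := by
          gcongr
          exact tsum_ofReal_mul_contourKernelIter_le w inc β α hbranch n γ
      _ = ENNReal.ofReal (w γ * ((α * t) ^ n / n.factorial)) := by
          rw [← ENNReal.ofReal_pow hα, ← ENNReal.ofReal_mul (by positivity),
            ← ENNReal.ofReal_mul (by positivity)]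
          congr 1
          ring
  have hwγ : 0 ≤ w γ := zero_le_one.trans (hw γ)
  have hsum : HasSum (fun n : ℕ => w γ * ((α * t) ^ n / n.factorial))
      (w γ * Real.exp (α * t)) := by
    rw [Real.exp_eq_exp_ℝ]
    exact (NormedSpace.expSeries_div_hasSum_exp (α * t)).mul_left (w γ)
  rw [← hsum.tsum_eq, ENNReal.ofReal_tsum_of_nonneg (fun n => by positivity) hsum.summable]
  exact ENNReal.tsum_le_tsum hterm
end

section
/- If α ≥ 0 satisfies the branching condition and α₀ ≥ 0 satisfies the α₀ condition, then for every integer k ≥ 1, the sum over all k-chains satisfies Σ_{(γ₁,…,γ_k) k-chain} Π_{i=1}^k e^{−β|γᵢ|} ≤ α₀·α^{k−1}. -/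
open scoped ENNReal Classical

/-- A `k`-chain of contours: a tuple `(γ₁,…,γ_k)` with `γ₁ ∈ G₀` (the contours
containing the fixed site) and `γ_{i+1} ≁ γ_i` for all `1 ≤ i < k`.  Here
`inc θ γ` means "θ is incompatible with γ". -/
def IsContourChain {G : Type*} (inc : G → G → Prop) (G₀ : Set G) {k : ℕ}
    (c : Fin k → G) : Prop :=
  (∀ h : 0 < k, c ⟨0, h⟩ ∈ G₀) ∧
    ∀ (i : ℕ) (h : i + 1 < k), inc (c ⟨i + 1, h⟩) (c ⟨i, Nat.lt_of_succ_lt h⟩)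

theorem isContourChain_cons {G : Type*} (inc : G → G → Prop) (A : Set G) {n : ℕ} (γ : G)
    (c : Fin n → G) :
    IsContourChain inc A (Fin.cons γ c : Fin (n + 1) → G) ↔
      γ ∈ A ∧ IsContourChain inc {θ | inc θ γ} c := by
  constructor
  · rintro ⟨h₀, h⟩
    exact ⟨h₀ n.succ_pos, fun hn ↦ h 0 (Nat.succ_lt_succ hn),
      fun i hi ↦ h (i + 1) (Nat.succ_lt_succ hi)⟩
  · rintro ⟨hγ, h₀, h⟩
    refine ⟨fun _ ↦ hγ, fun i hi ↦ ?_⟩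
    cases i with
    | zero => exact h₀ (Nat.lt_of_succ_lt_succ hi)
    | succ i => exact h i (Nat.lt_of_succ_lt_succ hi)

/-- The total weight of the chains of length `n` that start in `A`. -/
noncomputable def chainWeight {G : Type*} (inc : G → G → Prop) (e : G → ℝ≥0∞) (A : Set G)
    (n : ℕ) : ℝ≥0∞ :=
  ∑' c : Fin n → G, if IsContourChain inc A c then ∏ i, e (c i) else 0

theorem chainWeight_zero {G : Type*} (inc : G → G → Prop) (e : G → ℝ≥0∞) (A : Set G) :
    chainWeight inc e A 0 = 1 := by
  simp [chainWeight, IsContourChain]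

theorem chainWeight_succ {G : Type*} (inc : G → G → Prop) (e : G → ℝ≥0∞) (A : Set G) (n : ℕ) :
    chainWeight inc e A (n + 1) =
      ∑' γ : G, if γ ∈ A then e γ * chainWeight inc e {θ | inc θ γ} n else 0 := by
  rw [chainWeight, ← (Fin.consEquiv fun _ ↦ G).tsum_eq, ENNReal.tsum_prod']
  refine tsum_congr fun γ ↦ ?_
  by_cases hγ : γ ∈ A
  · simp [Fin.consEquiv, isContourChain_cons, hγ, chainWeight, ← ENNReal.tsum_mul_left,
      Fin.prod_univ_succ]
  · simp [Fin.consEquiv, isContourChain_cons, hγ]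

theorem chainWeight_inc_le {G : Type*} (inc : G → G → Prop) (e W : G → ℝ≥0∞)
    (hW : ∀ γ, 1 ≤ W γ) (a : ℝ≥0∞)
    (hbranch : ∀ γ, ∑' θ, (if inc θ γ then W θ * e θ else 0) ≤ a * W γ) (n : ℕ) (γ : G) :
    chainWeight inc e {θ | inc θ γ} n ≤ a ^ n * W γ := by
  induction n generalizing γ with
  | zero => simpa [chainWeight_zero] using hW γ
  | succ n ih =>
    calc chainWeight inc e {θ | inc θ γ} (n + 1)
      _ ≤ ∑' θ, a ^ n * (if inc θ γ then W θ * e θ else 0) := by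
        rw [chainWeight_succ]
        refine ENNReal.tsum_le_tsum fun θ ↦ ?_
        by_cases h : inc θ γ
        · simpa [h, mul_comm, mul_left_comm, mul_assoc] using mul_le_mul_right (ih θ) (e θ)
        · simp [h]
      _ ≤ a ^ n * (a * W γ) := by
        rw [ENNReal.tsum_mul_left]
        gcongr
        exact hbranch γ
      _ = a ^ (n + 1) * W γ := by ring

/-- Display (701)–(702) of Fernández–Ferrari–García: if `α` satisfies the branching
condition and `α₀` the `α₀`-condition, then the sum over all `k`-chains of the
product of the weights `e^{-β|γᵢ|}` is at most `α₀ α^{k-1}`. -/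
theorem chain_sum_le {G : Type*} [Countable G] (w : G → ℝ) (hw : ∀ γ : G, 1 ≤ w γ)
    (inc : G → G → Prop) (β : ℝ) (α : ℝ) (hα : 0 ≤ α)
    (hbranch : ∀ γ : G,
      ∑' θ : G, (if inc θ γ then ENNReal.ofReal (w θ * Real.exp (-β * w θ)) else 0) ≤
        ENNReal.ofReal α * ENNReal.ofReal (w γ))
    (G₀ : Set G) (α₀ : ℝ) (hα₀pos : 0 ≤ α₀)
    (hα₀ : ∑' γ : G₀, ENNReal.ofReal (w γ * Real.exp (-β * w γ)) ≤ ENNReal.ofReal α₀)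
    (k : ℕ) (hk : 1 ≤ k) :
    ∑' c : Fin k → G,
        (if IsContourChain inc G₀ c then
          ENNReal.ofReal (∏ i : Fin k, Real.exp (-β * w (c i))) else 0) ≤
      ENNReal.ofReal (α₀ * α ^ (k - 1)) := by
  obtain ⟨n, rfl⟩ : ∃ n, k = n + 1 := ⟨k - 1, by omega⟩
  set e : G → ℝ≥0∞ := fun γ ↦ ENNReal.ofReal (Real.exp (-β * w γ))
  set W : G → ℝ≥0∞ := fun γ ↦ ENNReal.ofReal (w γ)
  have hWe (γ : G) : ENNReal.ofReal (w γ * Real.exp (-β * w γ)) = W γ * e γ :=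
    ENNReal.ofReal_mul (zero_le_one.trans (hw γ))
  have hW (γ : G) : 1 ≤ W γ := ENNReal.one_le_ofReal.2 (hw γ)
  simp only [hWe] at hbranch hα₀
  simp only [ENNReal.ofReal_prod_of_nonneg fun _ _ ↦ (Real.exp_pos _).le]
  rw [ENNReal.ofReal_mul hα₀pos, ENNReal.ofReal_pow hα, Nat.add_sub_cancel]
  calc chainWeight inc e G₀ (n + 1)
    _ ≤ ∑' γ, (G₀.indicator (fun γ ↦ W γ * e γ) γ) * ENNReal.ofReal α ^ n := by
      rw [chainWeight_succ]
      refine ENNReal.tsum_le_tsum fun γ ↦ ?_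
      by_cases h : γ ∈ G₀
      · simpa [h, mul_comm, mul_left_comm, mul_assoc] using
          mul_le_mul_right (chainWeight_inc_le inc e W hW _ hbranch n γ) (e γ)
      · simp [h]
    _ ≤ ENNReal.ofReal α₀ * ENNReal.ofReal α ^ n := by
      rw [ENNReal.tsum_mul_right, ← tsum_subtype]
      gcongr
end
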